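/- If two pointed systems are α-bisimilar, then they satisfy the same L^◇_∞-formulas of modal-quantifier rank at most α: if (𝓜, M, ā) ↔_α (𝓝, N, b̄), then for every L^◇_∞-formula φ with mqrank(φ) ≤ α, 𝓜, M ⊨ φ[ā] iff 𝓝, N ⊨ φ[b̄]. (Fundamental Theorem of α-bisimulations.) -/

import Mathlib

open FirstOrder Language

namespace Potentialist

/-- The underlying data of a potentialist system: a collection of worlds, each carrying a
first-order `L`-structure. -/
structure PreSys.{u, v, w, x} (L : FirstOrder.Language.{u, v}) where
  World : Type w
  Dom : World → Type x
  str : ∀ W, L.Structure (Dom W)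

attribute [instance] PreSys.str

/-- A potentialist system: a collection of first-order `L`-structures together with a
collection of `L`-embeddings between them, containing all identity embeddings and closed
under composition. -/
structure PotSys.{u, v, w, x} (L : FirstOrder.Language.{u, v})
    extends PreSys.{u, v, w, x} L where
  Emb : ∀ W W' : World, Set (Dom W ↪[L] Dom W')
  id_mem : ∀ W : World, Embedding.refl L (Dom W) ∈ Emb W W
  comp_mem : ∀ {W W' W'' : World} (f : Dom W ↪[L] Dom W') (g : Dom W' ↪[L] Dom W''),
    f ∈ Emb W W' → g ∈ Emb W' W'' → g.comp f ∈ Emb W W''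

/-- Two tuples (in possibly different structures) satisfy the same atomic `L`-formulas. -/
def AtomicEquiv.{u, v, y, z} (L : FirstOrder.Language.{u, v}) {M : Type y} {N : Type z}
    [L.Structure M] [L.Structure N] {n : ℕ} (a : Fin n → M) (b : Fin n → N) : Prop :=
  ∀ φ : L.Formula (Fin n), BoundedFormula.IsAtomic φ → (φ.Realize a ↔ φ.Realize b)

/-- The type of relations between pairs `(M, ā)` and `(N, b̄)` of equal parameter size. -/
abbrev BisimRel.{u, v, w, x, w', x'} {L : FirstOrder.Language.{u, v}}
    (S : PotSys.{u, v, w, x} L) (T : PotSys.{u, v, w', x'} L) :=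
  ∀ (n : ℕ) (M : S.World), (Fin n → S.Dom M) → ∀ N : T.World, (Fin n → T.Dom N) → Prop

/-- `R` is a bisimulation between the potentialist systems `S` and `T`: it is nonempty, and
whenever `R` relates `(M, ā)` to `(N, b̄)`: (B1) `ā` and `b̄` satisfy the same atomic formulas;
(B2) any extension of either tuple by one element can be matched on the other side;
(B3) any embedding on either side can be matched by an embedding on the other side. -/
def IsBisimulation.{u, v, w, x, w', x'} {L : FirstOrder.Language.{u, v}}
    (S : PotSys.{u, v, w, x} L) (T : PotSys.{u, v, w', x'} L) (R : BisimRel S T) : Prop :=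
  (∃ n M a N b, R n M a N b) ∧
  ∀ (n : ℕ) (M : S.World) (a : Fin n → S.Dom M) (N : T.World) (b : Fin n → T.Dom N),
    R n M a N b →
      AtomicEquiv L a b ∧
      (∀ c : S.Dom M, ∃ d : T.Dom N, R (n + 1) M (Fin.snoc a c) N (Fin.snoc b d)) ∧
      (∀ d : T.Dom N, ∃ c : S.Dom M, R (n + 1) M (Fin.snoc a c) N (Fin.snoc b d)) ∧
      (∀ (M' : S.World) (π : S.Dom M ↪[L] S.Dom M'), π ∈ S.Emb M M' →
        ∃ (N' : T.World) (ρ : T.Dom N ↪[L] T.Dom N'), ρ ∈ T.Emb N N' ∧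
          R n M' (fun i => π (a i)) N' (fun i => ρ (b i))) ∧
      (∀ (N' : T.World) (ρ : T.Dom N ↪[L] T.Dom N'), ρ ∈ T.Emb N N' →
        ∃ (M' : S.World) (π : S.Dom M ↪[L] S.Dom M'), π ∈ S.Emb M M' ∧
          R n M' (fun i => π (a i)) N' (fun i => ρ (b i)))

/-- Two pointed systems are bisimilar if some bisimulation relates them. -/
def Bisimilar.{u, v, w, x, w', x'} {L : FirstOrder.Language.{u, v}}
    (S : PotSys.{u, v, w, x} L) (T : PotSys.{u, v, w', x'} L)
    {n : ℕ} (M : S.World) (a : Fin n → S.Dom M) (N : T.World) (b : Fin n → T.Dom N) : Prop :=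
  ∃ R : BisimRel S T, IsBisimulation S T R ∧ R n M a N b

/-- A relation is bitotal if every pair on the left is related to some pair on the right
and vice versa. -/
def Bitotal.{u, v, w, x, w', x'} {L : FirstOrder.Language.{u, v}}
    (S : PotSys.{u, v, w, x} L) (T : PotSys.{u, v, w', x'} L) (R : BisimRel S T) : Prop :=
  (∀ (n : ℕ) (M : S.World) (a : Fin n → S.Dom M), ∃ N b, R n M a N b) ∧
  (∀ (n : ℕ) (N : T.World) (b : Fin n → T.Dom N), ∃ M a, R n M a N b)

/-- Two potentialist systems are bitotally bisimilar if there is a bitotal bisimulation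
between them. -/
def BitotallyBisimilar.{u, v, w, x, w', x'} {L : FirstOrder.Language.{u, v}}
    (S : PotSys.{u, v, w, x} L) (T : PotSys.{u, v, w', x'} L) : Prop :=
  ∃ R : BisimRel S T, IsBisimulation S T R ∧ Bitotal S T R

/-- An iso-bisimulation between potentialist systems: a nonempty relation between worlds
together with a system of isomorphisms, such that embeddings on either side can be matched
by embeddings on the other side, commuting with the isomorphisms. -/
structure IsoBisim.{u, v, w, x, w', x'} {L : FirstOrder.Language.{u, v}}
    (S : PotSys.{u, v, w, x} L) (T : PotSys.{u, v, w', x'} L) where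
  rel : S.World → T.World → Prop
  nonempty : ∃ M N, rel M N
  iso : ∀ {M : S.World} {N : T.World}, rel M N → (S.Dom M ≃[L] T.Dom N)
  forth : ∀ {M : S.World} {N : T.World} (h : rel M N) (M' : S.World)
      (π : S.Dom M ↪[L] S.Dom M'), π ∈ S.Emb M M' →
      ∃ (N' : T.World) (ρ : T.Dom N ↪[L] T.Dom N') (_ : ρ ∈ T.Emb N N') (h' : rel M' N'),
        ∀ y : S.Dom M, iso h' (π y) = ρ (iso h y)
  back : ∀ {M : S.World} {N : T.World} (h : rel M N) (N' : T.World)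
      (ρ : T.Dom N ↪[L] T.Dom N'), ρ ∈ T.Emb N N' →
      ∃ (M' : S.World) (π : S.Dom M ↪[L] S.Dom M') (_ : π ∈ S.Emb M M') (h' : rel M' N'),
        ∀ y : S.Dom M, iso h' (π y) = ρ (iso h y)

/-- An iso-bisimulation is bitotal if every world on either side takes part in the relation. -/
def IsoBisim.Bitotal.{u, v, w, x, w', x'} {L : FirstOrder.Language.{u, v}}
    {S : PotSys.{u, v, w, x} L} {T : PotSys.{u, v, w', x'} L} (I : IsoBisim S T) : Prop :=
  (∀ M : S.World, ∃ N, I.rel M N) ∧ (∀ N : T.World, ∃ M, I.rel M N)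


/-- Formulas of the infinitary modal language `L^◇_∞`, with free variables among `Fin n`:
built from atomic `L`-formulas by negation, conjunctions and disjunctions indexed by an
arbitrary type (so that each formula has only finitely many free variables), quantifiers,
and the modal operators `◇` and `□`. -/
inductive MFormula.{t, u, v} (L : FirstOrder.Language.{u, v}) : ℕ → Type (max u v (t + 1))
  | equal {n : ℕ} (t₁ t₂ : L.Term (Fin n)) : MFormula L n
  | rel {n l : ℕ} (R : L.Relations l) (ts : Fin l → L.Term (Fin n)) : MFormula L n
  | not {n : ℕ} (φ : MFormula L n) : MFormula L n
  | iAll {n : ℕ} {ι : Type t} (φ : ι → MFormula L n) : MFormula L n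
  | iEx {n : ℕ} {ι : Type t} (φ : ι → MFormula L n) : MFormula L n
  | all {n : ℕ} (φ : MFormula L (n + 1)) : MFormula L n
  | ex {n : ℕ} (φ : MFormula L (n + 1)) : MFormula L n
  | box {n : ℕ} (φ : MFormula L n) : MFormula L n
  | dia {n : ℕ} (φ : MFormula L n) : MFormula L n

/-- Satisfaction of an `L^◇_∞`-formula at a world of a potentialist system, with a tuple of
parameters: `◇φ` holds iff `φ` holds at the image of the parameters under some embedding of
the system, and `□φ` holds iff `φ` holds under every such embedding. -/
def Sat.{t, u, v, w, x} {L : FirstOrder.Language.{u, v}} (S : PotSys.{u, v, w, x} L) :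
    {n : ℕ} → (W : S.World) → (Fin n → S.Dom W) → MFormula.{t, u, v} L n → Prop
  | _, _, a, .equal t₁ t₂ => t₁.realize a = t₂.realize a
  | _, _, a, .rel R ts => Structure.RelMap R fun i => (ts i).realize a
  | _, W, a, .not φ => ¬ Sat S W a φ
  | _, W, a, .iAll φ => ∀ i, Sat S W a (φ i)
  | _, W, a, .iEx φ => ∃ i, Sat S W a (φ i)
  | _, W, a, .all φ => ∀ c, Sat S W (Fin.snoc a c) φ
  | _, W, a, .ex φ => ∃ c, Sat S W (Fin.snoc a c) φ
  | _, W, a, .box φ => ∀ (W' : S.World) (π : S.Dom W ↪[L] S.Dom W'),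
      π ∈ S.Emb W W' → Sat S W' (fun i => π (a i)) φ
  | _, W, a, .dia φ => ∃ (W' : S.World) (π : S.Dom W ↪[L] S.Dom W'),
      π ∈ S.Emb W W' ∧ Sat S W' (fun i => π (a i)) φ

/-- The modal-quantifier rank of an `L^◇_∞`-formula: atomic formulas have rank `0`;
negation preserves rank; conjunctions and disjunctions take the supremum of the ranks;
quantifiers and modal operators add `1`. -/
noncomputable def mqrank.{t, u, v} {L : FirstOrder.Language.{u, v}} :
    {n : ℕ} → MFormula.{t, u, v} L n → Ordinal.{t}
  | _, .equal _ _ => 0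
  | _, .rel _ _ => 0
  | _, .not φ => mqrank φ
  | _, .iAll φ => ⨆ i, mqrank (φ i)
  | _, .iEx φ => ⨆ i, mqrank (φ i)
  | _, .all φ => mqrank φ + 1
  | _, .ex φ => mqrank φ + 1
  | _, .box φ => mqrank φ + 1
  | _, .dia φ => mqrank φ + 1

/-- The type of ordinal-indexed families of relations between pairs `(M, ā)` and `(N, b̄)`. -/
abbrev AlphaBisimRel.{r, u, v, w, x, w', x'} {L : FirstOrder.Language.{u, v}}
    (S : PotSys.{u, v, w, x} L) (T : PotSys.{u, v, w', x'} L) :=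
  Ordinal.{r} → ∀ (n : ℕ) (M : S.World), (Fin n → S.Dom M) → ∀ N : T.World, (Fin n → T.Dom N) → Prop

/-- `R` is an `α`-bisimulation between `S` and `T`: a family of nonempty relations `R β`
for `β ≤ α` such that whenever `R β` relates `(M, ā)` to `(N, b̄)`: (αB1) `ā` and `b̄` satisfy
the same atomic formulas; (αB2) for every `γ < β`, any one-element extension of either tuple
can be matched by the other at level `γ`; (αB3) for every `γ < β`, any embedding on either
side can be matched by one on the other side at level `γ`. -/
def IsAlphaBisimulation.{r, u, v, w, x, w', x'} {L : FirstOrder.Language.{u, v}}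
    (S : PotSys.{u, v, w, x} L) (T : PotSys.{u, v, w', x'} L) (α : Ordinal.{r})
    (R : AlphaBisimRel.{r} S T) : Prop :=
  (∀ β ≤ α, ∃ n M a N b, R β n M a N b) ∧
  ∀ β ≤ α, ∀ (n : ℕ) (M : S.World) (a : Fin n → S.Dom M) (N : T.World) (b : Fin n → T.Dom N),
    R β n M a N b →
      AtomicEquiv L a b ∧
      (∀ γ < β, ∀ c : S.Dom M, ∃ d : T.Dom N,
        R γ (n + 1) M (Fin.snoc a c) N (Fin.snoc b d)) ∧
      (∀ γ < β, ∀ d : T.Dom N, ∃ c : S.Dom M,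
        R γ (n + 1) M (Fin.snoc a c) N (Fin.snoc b d)) ∧
      (∀ γ < β, ∀ (M' : S.World) (π : S.Dom M ↪[L] S.Dom M'), π ∈ S.Emb M M' →
        ∃ (N' : T.World) (ρ : T.Dom N ↪[L] T.Dom N'), ρ ∈ T.Emb N N' ∧
          R γ n M' (fun i => π (a i)) N' (fun i => ρ (b i))) ∧
      (∀ γ < β, ∀ (N' : T.World) (ρ : T.Dom N ↪[L] T.Dom N'), ρ ∈ T.Emb N N' →
        ∃ (M' : S.World) (π : S.Dom M ↪[L] S.Dom M'), π ∈ S.Emb M M' ∧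
          R γ n M' (fun i => π (a i)) N' (fun i => ρ (b i)))

/-- Two pointed systems are `α`-bisimilar if some `α`-bisimulation relates them at level `α`. -/
def AlphaBisimilar.{r, u, v, w, x, w', x'} {L : FirstOrder.Language.{u, v}}
    (S : PotSys.{u, v, w, x} L) (T : PotSys.{u, v, w', x'} L) (α : Ordinal.{r})
    {n : ℕ} (M : S.World) (a : Fin n → S.Dom M) (N : T.World) (b : Fin n → T.Dom N) : Prop :=
  ∃ R : AlphaBisimRel.{r} S T, IsAlphaBisimulation S T α R ∧ R α n M a N b

/-- `RankGE S T α n M a N b` expresses that the position `(M, ā, N, b̄)` of the modal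
Ehrenfeucht–Fraïssé game board between `S` and `T` has rank at least `α`: the tuples satisfy
the same atomic formulas, and for every `β < α`, every move of Abelard from this position
(choosing an element on either side, or an embedding on either side) can be answered by
Eloise reaching a position of rank at least `β`. -/
def RankGE.{r, u, v, w, x, w', x'} {L : FirstOrder.Language.{u, v}}
    (S : PotSys.{u, v, w, x} L) (T : PotSys.{u, v, w', x'} L) (α : Ordinal.{r})
    (n : ℕ) (M : S.World) (a : Fin n → S.Dom M) (N : T.World) (b : Fin n → T.Dom N) : Prop :=
  AtomicEquiv L a b ∧
  ∀ β < α,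
    (∀ c : S.Dom M, ∃ d : T.Dom N,
      RankGE S T β (n + 1) M (Fin.snoc a c) N (Fin.snoc b d)) ∧
    (∀ d : T.Dom N, ∃ c : S.Dom M,
      RankGE S T β (n + 1) M (Fin.snoc a c) N (Fin.snoc b d)) ∧
    (∀ (M' : S.World) (π : S.Dom M ↪[L] S.Dom M'), π ∈ S.Emb M M' →
      ∃ (N' : T.World) (ρ : T.Dom N ↪[L] T.Dom N'), ρ ∈ T.Emb N N' ∧
        RankGE S T β n M' (fun i => π (a i)) N' (fun i => ρ (b i))) ∧
    (∀ (N' : T.World) (ρ : T.Dom N ↪[L] T.Dom N'), ρ ∈ T.Emb N N' →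
      ∃ (M' : S.World) (π : S.Dom M ↪[L] S.Dom M'), π ∈ S.Emb M M' ∧
        RankGE S T β n M' (fun i => π (a i)) N' (fun i => ρ (b i)))
termination_by α


/-- Tuples satisfying the same atomic formulas agree on equalities between terms. -/
theorem AtomicEquiv.realize_term_eq_iff.{u, v, y, z} {L : FirstOrder.Language.{u, v}}
    {M : Type y} {N : Type z} [L.Structure M] [L.Structure N] {n : ℕ}
    {a : Fin n → M} {b : Fin n → N} (h : AtomicEquiv L a b) (t₁ t₂ : L.Term (Fin n)) :
    t₁.realize a = t₂.realize a ↔ t₁.realize b = t₂.realize b := by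
  have h' := h (Term.equal t₁ t₂) (BoundedFormula.IsAtomic.equal _ _)
  simpa only [Formula.realize_equal] using h'

/-- Tuples satisfying the same atomic formulas agree on relations between terms. -/
theorem AtomicEquiv.relMap_iff.{u, v, y, z} {L : FirstOrder.Language.{u, v}}
    {M : Type y} {N : Type z} [L.Structure M] [L.Structure N] {n l : ℕ}
    {a : Fin n → M} {b : Fin n → N} (h : AtomicEquiv L a b)
    (R : L.Relations l) (ts : Fin l → L.Term (Fin n)) :
    (Structure.RelMap R fun i => (ts i).realize a) ↔
      Structure.RelMap R fun i => (ts i).realize b := by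
  have h' := h (R.formula ts) (BoundedFormula.IsAtomic.rel _ _)
  simpa only [Formula.realize_rel] using h'

/-- Positions related at level `β` of an `α`-bisimulation satisfy the same formulas of
modal-quantifier rank at most `β`. -/
theorem IsAlphaBisimulation.sat_iff.{r, u, v, w, x, w', x'}
    {L : FirstOrder.Language.{u, v}}
    {S : PotSys.{u, v, w, x} L} {T : PotSys.{u, v, w', x'} L} {α : Ordinal.{r}}
    {R : AlphaBisimRel.{r} S T} (hR : IsAlphaBisimulation S T α R)
    {n : ℕ} (φ : MFormula.{r, u, v} L n) {β : Ordinal.{r}} (hβ : β ≤ α) (hφ : mqrank φ ≤ β)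
    {M : S.World} {a : Fin n → S.Dom M} {N : T.World} {b : Fin n → T.Dom N}
    (h : R β n M a N b) : Sat S M a φ ↔ Sat T N b φ := by
  induction φ generalizing β M N with
  | equal t₁ t₂ =>
    simpa only [Sat] using (hR.2 β hβ _ M a N b h).1.realize_term_eq_iff t₁ t₂
  | rel P ts => simpa only [Sat] using (hR.2 β hβ _ M a N b h).1.relMap_iff P ts
  | not φ ih =>
    simp only [mqrank] at hφ
    simp only [Sat, ih hβ hφ h]
  | iAll φ ih =>
    simp only [mqrank] at hφ
    simp only [Sat]
    exact forall_congr' fun i => ih i hβ ((Ordinal.le_iSup _ i).trans hφ) h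
  | iEx φ ih =>
    simp only [mqrank] at hφ
    simp only [Sat]
    exact exists_congr fun i => ih i hβ ((Ordinal.le_iSup _ i).trans hφ) h
  | all φ ih =>
    simp only [mqrank] at hφ
    have hlt : mqrank φ < β := Order.add_one_le_iff.mp hφ
    obtain ⟨-, forth, back, -, -⟩ := hR.2 β hβ _ M a N b h
    simp only [Sat]
    constructor
    · intro H d
      obtain ⟨c, hc⟩ := back _ hlt d
      exact (ih (hlt.le.trans hβ) le_rfl hc).mp (H c)
    · intro H c
      obtain ⟨d, hd⟩ := forth _ hlt c
      exact (ih (hlt.le.trans hβ) le_rfl hd).mpr (H d)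
  | ex φ ih =>
    simp only [mqrank] at hφ
    have hlt : mqrank φ < β := Order.add_one_le_iff.mp hφ
    obtain ⟨-, forth, back, -, -⟩ := hR.2 β hβ _ M a N b h
    simp only [Sat]
    constructor
    · rintro ⟨c, H⟩
      obtain ⟨d, hd⟩ := forth _ hlt c
      exact ⟨d, (ih (hlt.le.trans hβ) le_rfl hd).mp H⟩
    · rintro ⟨d, H⟩
      obtain ⟨c, hc⟩ := back _ hlt d
      exact ⟨c, (ih (hlt.le.trans hβ) le_rfl hc).mpr H⟩
  | box φ ih =>
    simp only [mqrank] at hφ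
    have hlt : mqrank φ < β := Order.add_one_le_iff.mp hφ
    obtain ⟨-, -, -, forth, back⟩ := hR.2 β hβ _ M a N b h
    simp only [Sat]
    constructor
    · intro H N' ρ hρ
      obtain ⟨M', π, hπ, hr⟩ := back _ hlt N' ρ hρ
      exact (ih (hlt.le.trans hβ) le_rfl hr).mp (H M' π hπ)
    · intro H M' π hπ
      obtain ⟨N', ρ, hρ, hr⟩ := forth _ hlt M' π hπ
      exact (ih (hlt.le.trans hβ) le_rfl hr).mpr (H N' ρ hρ)
  | dia φ ih =>
    simp only [mqrank] at hφ
    have hlt : mqrank φ < β := Order.add_one_le_iff.mp hφ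
    obtain ⟨-, -, -, forth, back⟩ := hR.2 β hβ _ M a N b h
    simp only [Sat]
    constructor
    · rintro ⟨M', π, hπ, H⟩
      obtain ⟨N', ρ, hρ, hr⟩ := forth _ hlt M' π hπ
      exact ⟨N', ρ, hρ, (ih (hlt.le.trans hβ) le_rfl hr).mp H⟩
    · rintro ⟨N', ρ, hρ, H⟩
      obtain ⟨M', π, hπ, hr⟩ := back _ hlt N' ρ hρ
      exact ⟨M', π, hπ, (ih (hlt.le.trans hβ) le_rfl hr).mpr H⟩

/-- **Fundamental Theorem of `α`-bisimulations** (Statement 2): if two pointed systems are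
`α`-bisimilar then they satisfy the same `L^◇_∞`-formulas of modal-quantifier rank at
most `α`. -/
theorem fundamental_theorem_of_alpha_bisimulations.{r, u, v, w, x, w', x'}
    {L : FirstOrder.Language.{u, v}}
    (S : PotSys.{u, v, w, x} L) (T : PotSys.{u, v, w', x'} L)
    {n : ℕ} (M : S.World) (a : Fin n → S.Dom M) (N : T.World) (b : Fin n → T.Dom N)
    (α : Ordinal.{r}) (h : AlphaBisimilar S T α M a N b)
    (φ : MFormula.{r, u, v} L n) (hφ : mqrank φ ≤ α) :
    Sat S M a φ ↔ Sat T N b φ := by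
  obtain ⟨R, hR, hab⟩ := h
  exact hR.sat_iff φ le_rfl hφ hab

end Potentialist
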